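/- Let F : ℝⁿ → ℝⁿ be a continuously differentiable vector field and M : ℝⁿ → ℝⁿˣⁿ a continuously differentiable symmetric-matrix-valued function with m̲·I ⪯ M(x) ⪯ m̄·I for all x, where 0 < m̲ ≤ m̄, and suppose the contraction condition ∂_F M(x) + DF(x)ᵀM(x) + M(x)DF(x) + 2λM(x) ≺ 0 holds for all x, with λ > 0. Let x₁ : [0,∞) → ℝⁿ solve the unperturbed system ẋ₁ = F(x₁), and let x₂ : [0,∞) → ℝⁿ solve the perturbed system ẋ₂ = F(x₂) + d(t) with a piecewise-continuous disturbance satisfying ‖d(t)‖₂ ≤ ε for all t. Define R₀ = inf over all C¹ paths γ : [0,1] → ℝⁿ with γ(0) = x₁(0) and γ(1) = x₂(0) of ∫₀¹ √( γ'(s)ᵀ M(γ(s)) γ'(s) ) ds. Then for all t ≥ 0: ‖x₁(t) − x₂(t)‖₂ ≤ (R₀/√m̲)·e^{−λt} + √(m̄/m̲)·(ε/λ)·(1 − e^{−λt}). -/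

import Mathlib

open Matrix
open scoped RealInnerProductSpace

open Set Filter Topology

variable {E : Type*} [NormedAddCommGroup E] [InnerProductSpace ℝ E]

/-- The length of `v` at the point `x` under the quadratic form given by the operator `A x`. -/
noncomputable def metricSpeed (A : E → E →L[ℝ] E) (x v : E) : ℝ := √⟪v, A x v⟫

/-- The length of the path `γ` on `[0, 1]` under the metric `A`. -/
noncomputable def metricLength (A : E → E →L[ℝ] E) (γ : ℝ → E) : ℝ :=
  ∫ s in (0 : ℝ)..1, metricSpeed A (γ s) (derivWithin γ (Icc 0 1) s)

/-- `ChainLengthLE A p q r` says that a finite chain of `C¹` paths of total length at most `r`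
joins `p` to `q`. -/
inductive ChainLengthLE (A : E → E →L[ℝ] E) : E → E → ℝ → Prop
  | path {γ : ℝ → E} {r : ℝ} (hγ : ContDiffOn ℝ 1 γ (Icc 0 1)) (hr : metricLength A γ ≤ r) :
      ChainLengthLE A (γ 0) (γ 1) r
  | trans {p q w : E} {r s : ℝ} (h₁ : ChainLengthLE A p q r) (h₂ : ChainLengthLE A q w s) :
      ChainLengthLE A p w (r + s)

/-- The infimal length of finite chains of `C¹` paths from `p` to `q`. -/
noncomputable def chainDist (A : E → E →L[ℝ] E) (p q : E) : ℝ :=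
  sInf {r | ChainLengthLE A p q r}

theorem mul_norm_le_metricSpeed {A : E → E →L[ℝ] E} {m : ℝ} (hm : 0 ≤ m)
    (hA : ∀ x v, m * ‖v‖ ^ 2 ≤ ⟪v, A x v⟫) (x v : E) : √m * ‖v‖ ≤ metricSpeed A x v := by
  rw [metricSpeed, ← Real.sqrt_sq (norm_nonneg v), ← Real.sqrt_mul hm]
  exact Real.sqrt_le_sqrt (hA x v)

theorem metricSpeed_le_mul_norm {A : E → E →L[ℝ] E} {m : ℝ} (hm : 0 ≤ m)
    (hA : ∀ x v, ⟪v, A x v⟫ ≤ m * ‖v‖ ^ 2) (x v : E) : metricSpeed A x v ≤ √m * ‖v‖ := by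
  rw [metricSpeed, ← Real.sqrt_sq (norm_nonneg v), ← Real.sqrt_mul hm]
  exact Real.sqrt_le_sqrt (hA x v)

theorem continuousOn_metricSpeed {A : E → E →L[ℝ] E} (hA : Continuous A) {γ : ℝ → E}
    (hγ : ContDiffOn ℝ 1 γ (Icc 0 1)) :
    ContinuousOn (fun s => metricSpeed A (γ s) (derivWithin γ (Icc 0 1) s)) (Icc 0 1) := by
  have h' : ContinuousOn (derivWithin γ (Icc 0 1)) (Icc 0 1) :=
    hγ.continuousOn_derivWithin (uniqueDiffOn_Icc zero_lt_one) le_rfl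
  exact (h'.inner ((hA.comp_continuousOn hγ.continuousOn).clm_apply h')).sqrt

theorem mul_norm_sub_le_metricLength [CompleteSpace E] {A : E → E →L[ℝ] E} {m : ℝ} (hm : 0 ≤ m)
    (hAc : Continuous A) (hA : ∀ x v, m * ‖v‖ ^ 2 ≤ ⟪v, A x v⟫) {γ : ℝ → E}
    (hγ : ContDiffOn ℝ 1 γ (Icc 0 1)) {s : ℝ} (hs : s ∈ Icc (0 : ℝ) 1) :
    √m * ‖γ s - γ 0‖ ≤ metricLength A γ := by
  have hsub : Icc 0 s ⊆ Icc (0 : ℝ) 1 := Icc_subset_Icc_right hs.2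
  have h' : ContinuousOn (derivWithin γ (Icc 0 1)) (Icc 0 1) :=
    hγ.continuousOn_derivWithin (uniqueDiffOn_Icc zero_lt_one) le_rfl
  have hS := continuousOn_metricSpeed hAc hγ
  have hFTC : ∫ u in (0 : ℝ)..s, derivWithin γ (Icc 0 1) u = γ s - γ 0 := by
    refine intervalIntegral.integral_eq_sub_of_hasDerivAt_of_le hs.1 (hγ.continuousOn.mono hsub)
      (fun u hu => ?_) ((h'.mono hsub).intervalIntegrable_of_Icc hs.1)
    have hu' : u ∈ Ioo (0 : ℝ) 1 := ⟨hu.1, hu.2.trans_le hs.2⟩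
    exact ((hγ.differentiableOn one_ne_zero u (Ioo_subset_Icc_self hu')).hasDerivWithinAt).hasDerivAt
      (Icc_mem_nhds hu'.1 hu'.2)
  calc √m * ‖γ s - γ 0‖ ≤ √m * ∫ u in (0 : ℝ)..s, ‖derivWithin γ (Icc 0 1) u‖ := by
        rw [← hFTC]
        gcongr
        exact intervalIntegral.norm_integral_le_integral_norm hs.1
    _ = ∫ u in (0 : ℝ)..s, √m * ‖derivWithin γ (Icc 0 1) u‖ := by
        rw [intervalIntegral.integral_const_mul]
    _ ≤ ∫ u in (0 : ℝ)..s, metricSpeed A (γ u) (derivWithin γ (Icc 0 1) u) :=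
        intervalIntegral.integral_mono_on hs.1
          (((h'.mono hsub).norm.const_mul _).intervalIntegrable_of_Icc hs.1)
          ((hS.mono hsub).intervalIntegrable_of_Icc hs.1)
          fun u _ => mul_norm_le_metricSpeed hm hA _ _
    _ ≤ metricLength A γ :=
        intervalIntegral.integral_mono_interval le_rfl hs.1 hs.2
          (Eventually.of_forall fun _ => Real.sqrt_nonneg _)
          (hS.intervalIntegrable_of_Icc zero_le_one)

theorem ChainLengthLE.mul_norm_sub_le [CompleteSpace E] {A : E → E →L[ℝ] E} {m : ℝ} (hm : 0 ≤ m)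
    (hAc : Continuous A) (hA : ∀ x v, m * ‖v‖ ^ 2 ≤ ⟪v, A x v⟫) {p q : E} {r : ℝ}
    (h : ChainLengthLE A p q r) : √m * ‖q - p‖ ≤ r := by
  induction h with
  | path hγ hr =>
    exact (mul_norm_sub_le_metricLength hm hAc hA hγ (right_mem_Icc.2 zero_le_one)).trans hr
  | @trans p q w r s _ _ ih₁ ih₂ =>
    have := norm_sub_le_norm_sub_add_norm_sub w q p
    nlinarith [Real.sqrt_nonneg m]

theorem ChainLengthLE.of_norm_sub {A : E → E →L[ℝ] E} {m : ℝ} (hm : 0 ≤ m)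
    (hAc : Continuous A) (hA : ∀ x v, ⟪v, A x v⟫ ≤ m * ‖v‖ ^ 2) (p q : E) :
    ChainLengthLE A p q (√m * ‖q - p‖) := by
  have hγ : ContDiff ℝ 1 (fun s : ℝ => p + s • (q - p)) := by fun_prop
  have hd : ∀ s ∈ Icc (0 : ℝ) 1,
      derivWithin (fun s : ℝ => p + s • (q - p)) (Icc 0 1) s = q - p := fun s hs => by
    have := ((hasDerivAt_id s).smul_const (q - p)).const_add p
    simpa using this.hasDerivWithinAt.derivWithin (uniqueDiffOn_Icc zero_lt_one s hs)
  have key : metricLength A (fun s : ℝ => p + s • (q - p)) ≤ √m * ‖q - p‖ := by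
    have h := intervalIntegral.integral_mono_on (μ := MeasureTheory.volume) zero_le_one
      ((continuousOn_metricSpeed hAc hγ.contDiffOn).intervalIntegrable_of_Icc zero_le_one)
      (intervalIntegrable_const (c := √m * ‖q - p‖)) fun s hs => by
        rw [hd s hs]
        exact metricSpeed_le_mul_norm hm hA _ _
    simpa [metricLength] using h
  simpa using ChainLengthLE.path hγ.contDiffOn key

theorem exists_chainLengthLE_lt {A : E → E →L[ℝ] E} {mhi : ℝ} (hhi : 0 ≤ mhi) (hAc : Continuous A)
    (hAhi : ∀ x v, ⟪v, A x v⟫ ≤ mhi * ‖v‖ ^ 2) {p q : E} {c : ℝ} (hc : chainDist A p q < c) :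
    ∃ r < c, ChainLengthLE A p q r := by
  obtain ⟨r, hr, hrc⟩ := exists_lt_of_csInf_lt ⟨_, .of_norm_sub hhi hAc hAhi p q⟩ hc
  exact ⟨r, hrc, hr⟩

section chainDist

variable [CompleteSpace E] {A : E → E →L[ℝ] E} {mlo mhi : ℝ}

theorem chainDist_le (hlo : 0 ≤ mlo) (hAc : Continuous A)
    (hA : ∀ x v, mlo * ‖v‖ ^ 2 ≤ ⟪v, A x v⟫) {p q : E} {r : ℝ} (h : ChainLengthLE A p q r) :
    chainDist A p q ≤ r :=
  csInf_le ⟨0, fun _ h => (by positivity : (0 : ℝ) ≤ √mlo * ‖q - p‖).trans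
    (h.mul_norm_sub_le hlo hAc hA)⟩ h

theorem chainDist_le_mul_norm (hlo : 0 ≤ mlo) (hhi : 0 ≤ mhi) (hAc : Continuous A)
    (hAlo : ∀ x v, mlo * ‖v‖ ^ 2 ≤ ⟪v, A x v⟫) (hAhi : ∀ x v, ⟪v, A x v⟫ ≤ mhi * ‖v‖ ^ 2)
    (p q : E) : chainDist A p q ≤ √mhi * ‖q - p‖ :=
  chainDist_le hlo hAc hAlo (.of_norm_sub hhi hAc hAhi p q)

theorem mul_norm_le_chainDist (hlo : 0 ≤ mlo) (hhi : 0 ≤ mhi) (hAc : Continuous A)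
    (hAlo : ∀ x v, mlo * ‖v‖ ^ 2 ≤ ⟪v, A x v⟫) (hAhi : ∀ x v, ⟪v, A x v⟫ ≤ mhi * ‖v‖ ^ 2)
    (p q : E) : √mlo * ‖q - p‖ ≤ chainDist A p q :=
  le_csInf ⟨_, .of_norm_sub hhi hAc hAhi p q⟩ fun _ h => h.mul_norm_sub_le hlo hAc hAlo

theorem chainDist_triangle (hlo : 0 ≤ mlo) (hhi : 0 ≤ mhi) (hAc : Continuous A)
    (hAlo : ∀ x v, mlo * ‖v‖ ^ 2 ≤ ⟪v, A x v⟫) (hAhi : ∀ x v, ⟪v, A x v⟫ ≤ mhi * ‖v‖ ^ 2)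
    (p q w : E) : chainDist A p w ≤ chainDist A p q + chainDist A q w := by
  refine le_of_forall_pos_le_add fun δ hδ => ?_
  obtain ⟨r, hr, h₁⟩ := exists_chainLengthLE_lt hhi hAc hAhi
    (show chainDist A p q < chainDist A p q + δ / 2 by linarith)
  obtain ⟨s, hs, h₂⟩ := exists_chainLengthLE_lt hhi hAc hAhi
    (show chainDist A q w < chainDist A q w + δ / 2 by linarith)
  linarith [chainDist_le hlo hAc hAlo (h₁.trans h₂)]

theorem chainDist_le_add_mul_norm (hlo : 0 ≤ mlo) (hhi : 0 ≤ mhi) (hAc : Continuous A)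
    (hAlo : ∀ x v, mlo * ‖v‖ ^ 2 ≤ ⟪v, A x v⟫) (hAhi : ∀ x v, ⟪v, A x v⟫ ≤ mhi * ‖v‖ ^ 2)
    (p q p' q' : E) :
    chainDist A p' q' ≤ chainDist A p q + √mhi * (‖p' - p‖ + ‖q' - q‖) := by
  have h₁ := chainDist_triangle hlo hhi hAc hAlo hAhi p' p q'
  have h₂ := chainDist_triangle hlo hhi hAc hAlo hAhi p q q'
  have h₃ := chainDist_le_mul_norm hlo hhi hAc hAlo hAhi p' p
  have h₄ := chainDist_le_mul_norm hlo hhi hAc hAlo hAhi q q'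
  rw [norm_sub_rev] at h₃
  linarith

theorem continuous_chainDist (hlo : 0 ≤ mlo) (hhi : 0 ≤ mhi) (hAc : Continuous A)
    (hAlo : ∀ x v, mlo * ‖v‖ ^ 2 ≤ ⟪v, A x v⟫) (hAhi : ∀ x v, ⟪v, A x v⟫ ≤ mhi * ‖v‖ ^ 2) :
    Continuous fun z : E × E => chainDist A z.1 z.2 := by
  refine continuous_iff_continuousAt.2 fun z => ?_
  have hlim : Tendsto (fun y : E × E => √mhi * (‖y.1 - z.1‖ + ‖y.2 - z.2‖)) (𝓝 z) (𝓝 0) := by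
    have : Continuous fun y : E × E => √mhi * (‖y.1 - z.1‖ + ‖y.2 - z.2‖) := by fun_prop
    simpa using this.tendsto z
  refine tendsto_iff_norm_sub_tendsto_zero.2
    (squeeze_zero (fun _ => norm_nonneg _) (fun y => ?_) hlim)
  have h₁ := chainDist_le_add_mul_norm hlo hhi hAc hAlo hAhi z.1 z.2 y.1 y.2
  have h₂ := chainDist_le_add_mul_norm hlo hhi hAc hAlo hAhi y.1 y.2 z.1 z.2
  rw [norm_sub_rev z.1, norm_sub_rev z.2] at h₂
  rw [Real.norm_eq_abs, abs_le]
  constructor <;> linarith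

end chainDist

/-- One explicit Euler step contracts the metric `A` infinitesimally, uniformly on compact sets. -/
theorem exists_euler_step_contracts [FiniteDimensional ℝ E] {A : E → E →L[ℝ] E} {F : E → E}
    {lam : ℝ} (hA : ContDiff ℝ 1 A) (hF : ContDiff ℝ 1 F)
    (hcontr : ∀ x v, v ≠ 0 → ⟪v, fderiv ℝ A x (F x) v⟫ + ⟪fderiv ℝ F x v, A x v⟫ +
      ⟪v, A x (fderiv ℝ F x v)⟫ + 2 * lam * ⟪v, A x v⟫ < 0) {K : Set E} (hK : IsCompact K) :
    ∃ h₀ > 0, ∀ h ∈ Icc 0 h₀, ∀ x ∈ K, ∀ v,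
      ⟪v + h • fderiv ℝ F x v, A (x + h • F x) (v + h • fderiv ℝ F x v)⟫ ≤
        (1 - lam * h) ^ 2 * ⟪v, A x v⟫ := by
  have hAc := hA.continuous
  have hFc := hF.continuous
  have hA' := hA.continuous_fderiv one_ne_zero
  have hF' := hF.continuous_fderiv one_ne_zero
  let G : ℝ → E × E → ℝ := fun h z =>
    ⟪z.2 + h • fderiv ℝ F z.1 z.2, A (z.1 + h • F z.1) (z.2 + h • fderiv ℝ F z.1 z.2)⟫ -
      (1 - lam * h) ^ 2 * ⟪z.2, A z.1 z.2⟫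
  let G' : ℝ → E × E → ℝ := fun h z =>
    ⟪z.2 + h • fderiv ℝ F z.1 z.2,
      fderiv ℝ A (z.1 + h • F z.1) (F z.1) (z.2 + h • fderiv ℝ F z.1 z.2) +
        A (z.1 + h • F z.1) (fderiv ℝ F z.1 z.2)⟫ +
    ⟪fderiv ℝ F z.1 z.2, A (z.1 + h • F z.1) (z.2 + h • fderiv ℝ F z.1 z.2)⟫ +
      2 * lam * (1 - lam * h) * ⟪z.2, A z.1 z.2⟫
  have hG : ∀ h z, HasDerivAt (fun h => G h z) (G' h z) h := fun h z => by
    have hy : HasDerivAt (fun h : ℝ => z.1 + h • F z.1) (F z.1) h := by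
      simpa using ((hasDerivAt_id h).smul_const (F z.1)).const_add z.1
    have hw : HasDerivAt (fun h : ℝ => z.2 + h • fderiv ℝ F z.1 z.2) (fderiv ℝ F z.1 z.2) h := by
      simpa using ((hasDerivAt_id h).smul_const (fderiv ℝ F z.1 z.2)).const_add z.2
    have hAy : HasDerivAt (fun h : ℝ => A (z.1 + h • F z.1))
        (fderiv ℝ A (z.1 + h • F z.1) (F z.1)) h :=
      ((hA.differentiable one_ne_zero _).hasFDerivAt).comp_hasDerivAt h hy
    have hsq : HasDerivAt (fun h : ℝ => (1 - lam * h) ^ 2) (2 * (1 - lam * h) * (-lam)) h := by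
      simpa using (((hasDerivAt_id h).const_mul lam).const_sub 1).fun_pow 2
    refine ((hw.inner ℝ (hAy.clm_apply hw)).sub (hsq.mul_const ⟪z.2, A z.1 z.2⟫)).congr_deriv ?_
    simp only [G']
    ring
  have hG'c : Continuous fun y : ℝ × (E × E) => G' y.1 y.2 := by
    have hD : Continuous fun y : ℝ × (E × E) => fderiv ℝ F y.2.1 y.2.2 := by fun_prop
    have hw : Continuous fun y : ℝ × (E × E) => y.2.2 + y.1 • fderiv ℝ F y.2.1 y.2.2 := by fun_prop
    have hy : Continuous fun y : ℝ × (E × E) => y.2.1 + y.1 • F y.2.1 := by fun_prop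
    have hdA : Continuous fun y : ℝ × (E × E) =>
        fderiv ℝ A (y.2.1 + y.1 • F y.2.1) (F y.2.1) :=
      (hA'.comp hy).clm_apply (hFc.comp (by fun_prop))
    exact ((hw.inner ((hdA.clm_apply hw).add ((hAc.comp hy).clm_apply hD))).add
      (hD.inner ((hAc.comp hy).clm_apply hw))).add (by fun_prop)
  have hneg : ∀ᶠ h in 𝓝 (0 : ℝ), ∀ z ∈ K ×ˢ Metric.sphere (0 : E) 1, G' h z < 0 := by
    refine (hK.prod (isCompact_sphere 0 1)).eventually_forall_of_forall_eventually fun z hz => ?_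
    refine (hG'c.tendsto (0, z)).eventually_lt_const ?_
    have := hcontr z.1 z.2 (ne_zero_of_mem_unit_sphere ⟨z.2, hz.2⟩)
    simp only [G', zero_smul, add_zero, mul_zero, sub_zero, mul_one, inner_add_right]
    linarith
  obtain ⟨δ, hδ, hball⟩ := Metric.eventually_nhds_iff.1 hneg
  refine ⟨δ / 2, half_pos hδ, fun h hh x hx v => ?_⟩
  have hunit : ∀ u ∈ Metric.sphere (0 : E) 1, G h (x, u) ≤ 0 := fun u hu => by
    have hanti : AntitoneOn (fun h => G h (x, u)) (Icc 0 (δ / 2)) := by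
      refine antitoneOn_of_deriv_nonpos (convex_Icc _ _)
        (fun h _ => (hG h (x, u)).continuousAt.continuousWithinAt)
        (fun h _ => (hG h (x, u)).differentiableAt.differentiableWithinAt) fun k hk => ?_
      rw [interior_Icc] at hk
      rw [(hG k (x, u)).deriv]
      refine (hball ?_ (x, u) ⟨hx, hu⟩).le
      rw [Real.dist_0_eq_abs, abs_of_pos hk.1]
      linarith [hk.2]
    have := hanti (left_mem_Icc.2 (half_pos hδ).le) hh hh.1
    simpa [G] using this
  rcases eq_or_ne v 0 with rfl | hv
  · simp
  have hu := hunit (‖v‖⁻¹ • v) (by simp [norm_smul, hv])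
  have hscale : G h (x, ‖v‖⁻¹ • v) = ‖v‖⁻¹ ^ 2 * G h (x, v) := by
    simp only [G, map_smul, smul_comm h, ← smul_add, inner_smul_left, inner_smul_right]
    simp
    ring
  rw [hscale] at hu
  have hpos : 0 < ‖v‖⁻¹ ^ 2 := by positivity
  exact sub_nonpos.1 (nonpos_of_mul_nonpos_right hu hpos)

theorem ChainLengthLE.euler_step [CompleteSpace E] {A : E → E →L[ℝ] E} {F : E → E} {m c h : ℝ}
    {K : Set E} (hm : 0 < m) (hc : 0 ≤ c) (hAc : Continuous A) (hF : ContDiff ℝ 1 F)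
    (hA : ∀ x v, m * ‖v‖ ^ 2 ≤ ⟪v, A x v⟫)
    (hstep : ∀ x ∈ K, ∀ v,
      ⟪v + h • fderiv ℝ F x v, A (x + h • F x) (v + h • fderiv ℝ F x v)⟫ ≤ c ^ 2 * ⟪v, A x v⟫)
    {p q : E} {r : ℝ} (hchain : ChainLengthLE A p q r)
    (hK : Metric.closedBall p (r / √m) ⊆ K) :
    ChainLengthLE A (p + h • F p) (q + h • F q) (c * r) := by
  have hm' : 0 < √m := Real.sqrt_pos.2 hm
  induction hchain with
  | @path γ r hγ hr =>
    have hγF : ContDiffOn ℝ 1 (fun s => γ s + h • F (γ s)) (Icc 0 1) :=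
      hγ.add ((hF.comp_contDiffOn hγ).const_smul h)
    refine ChainLengthLE.path (γ := fun s => γ s + h • F (γ s)) hγF ?_
    have hle : metricLength A (fun s => γ s + h • F (γ s)) ≤ c * metricLength A γ := by
      rw [metricLength, metricLength, ← intervalIntegral.integral_const_mul]
      refine intervalIntegral.integral_mono_on zero_le_one
        ((continuousOn_metricSpeed hAc hγF).intervalIntegrable_of_Icc zero_le_one)
        (((continuousOn_metricSpeed hAc hγ).const_mul c).intervalIntegrable_of_Icc zero_le_one)
        fun s hs => ?_
      have hd := (hγ.differentiableOn one_ne_zero s hs).hasDerivWithinAt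
      have hd' := hd.add
        (((hF.differentiable one_ne_zero (γ s)).hasFDerivAt.comp_hasDerivWithinAt s hd).const_smul h)
      have hd'' : derivWithin (fun s => γ s + h • F (γ s)) (Icc 0 1) s =
          derivWithin γ (Icc 0 1) s + h • fderiv ℝ F (γ s) (derivWithin γ (Icc 0 1) s) :=
        hd'.derivWithin (uniqueDiffOn_Icc zero_lt_one s hs)
      have hγK : γ s ∈ K := by
        refine hK ?_
        rw [Metric.mem_closedBall, dist_eq_norm, le_div_iff₀ hm', mul_comm]
        exact (mul_norm_sub_le_metricLength hm.le hAc hA hγ hs).trans hr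
      rw [hd'', metricSpeed, metricSpeed, ← Real.sqrt_sq hc, ← Real.sqrt_mul (sq_nonneg _)]
      exact Real.sqrt_le_sqrt (hstep _ hγK _)
    exact hle.trans (by gcongr)
  | @trans p q w r s h₁ h₂ ih₁ ih₂ =>
    have hr := h₁.mul_norm_sub_le hm.le hAc hA
    have hs := h₂.mul_norm_sub_le hm.le hAc hA
    have hs0 : 0 ≤ s := le_trans (by positivity) hs
    rw [mul_add]
    refine (ih₁ ((Metric.closedBall_subset_closedBall ?_).trans hK)).trans
      (ih₂ ((Metric.closedBall_subset_closedBall' ?_).trans hK))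
    · gcongr
      linarith
    · rw [dist_eq_norm, add_comm r s, add_div]
      gcongr
      rwa [le_div_iff₀ hm', mul_comm]

theorem eventually_chainDist_euler_le [FiniteDimensional ℝ E] {A : E → E →L[ℝ] E} {F : E → E}
    {lam mlo mhi : ℝ} (hlam : 0 < lam) (hlo : 0 < mlo) (hhi : 0 ≤ mhi)
    (hA : ContDiff ℝ 1 A) (hF : ContDiff ℝ 1 F)
    (hAlo : ∀ x v, mlo * ‖v‖ ^ 2 ≤ ⟪v, A x v⟫) (hAhi : ∀ x v, ⟪v, A x v⟫ ≤ mhi * ‖v‖ ^ 2)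
    (hcontr : ∀ x v, v ≠ 0 → ⟪v, fderiv ℝ A x (F x) v⟫ + ⟪fderiv ℝ F x v, A x v⟫ +
      ⟪v, A x (fderiv ℝ F x v)⟫ + 2 * lam * ⟪v, A x v⟫ < 0) (p q : E) :
    ∀ᶠ h in 𝓝[>] (0 : ℝ),
      chainDist A (p + h • F p) (q + h • F q) ≤ (1 - lam * h) * chainDist A p q := by
  have : CompleteSpace E := FiniteDimensional.complete ℝ E
  have hK := isCompact_closedBall p ((chainDist A p q + 1) / √mlo)
  obtain ⟨h₀, hh₀, hstep⟩ := exists_euler_step_contracts hA hF hcontr hK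
  filter_upwards [Ioo_mem_nhdsGT (lt_min hh₀ (inv_pos.2 hlam))] with h hh
  have hc : 0 < 1 - lam * h := by
    have := mul_lt_mul_of_pos_left (hh.2.trans_le (min_le_right _ _)) hlam
    rw [mul_inv_cancel₀ hlam.ne'] at this
    linarith
  rw [← div_le_iff₀' hc]
  refine le_of_forall_pos_le_add fun δ hδ => ?_
  obtain ⟨r, hr, hchain⟩ := exists_chainLengthLE_lt hhi hA.continuous hAhi
    (lt_add_of_pos_right (chainDist A p q) (lt_min hδ one_pos))
  have hr1 : r ≤ chainDist A p q + 1 := hr.le.trans (by gcongr; exact min_le_right _ _)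
  have hrδ : r ≤ chainDist A p q + δ := hr.le.trans (by gcongr; exact min_le_left _ _)
  rw [div_le_iff₀' hc]
  refine (chainDist_le hlo.le hA.continuous hAlo (hchain.euler_step hlo hc.le hA.continuous hF hAlo
    (hstep h ⟨hh.1.le, hh.2.le.trans (min_le_left _ _)⟩)
    (Metric.closedBall_subset_closedBall (by gcongr)))).trans (by gcongr)

theorem eventually_norm_sub_le_of_hasDerivWithinAt_Ici {x : ℝ → E} {v : E} {t : ℝ} (ht : 0 ≤ t)
    (hx : HasDerivWithinAt x v (Ici 0) t) {c : ℝ} (hc : 0 < c) :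
    ∀ᶠ z in 𝓝[>] t, ‖x z - (x t + (z - t) • v)‖ ≤ c * (z - t) := by
  have h := (hx.mono (Ioi_subset_Ici ht : Ioi t ⊆ Ici 0)).isLittleO.def hc
  filter_upwards [h, self_mem_nhdsWithin] with z hz hzt
  rw [Real.norm_of_nonneg (sub_nonneg.2 (le_of_lt hzt))] at hz
  rwa [← sub_sub]

/-- The chain distance between a trajectory and a perturbed trajectory of a contracting vector
field obeys a Grönwall estimate. -/
theorem chainDist_trajectories_le [FiniteDimensional ℝ E] {A : E → E →L[ℝ] E} {F : E → E}
    {lam mlo mhi ε : ℝ} (hlam : 0 < lam) (hlo : 0 < mlo) (hhi : 0 ≤ mhi)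
    (hA : ContDiff ℝ 1 A) (hF : ContDiff ℝ 1 F)
    (hAlo : ∀ x v, mlo * ‖v‖ ^ 2 ≤ ⟪v, A x v⟫) (hAhi : ∀ x v, ⟪v, A x v⟫ ≤ mhi * ‖v‖ ^ 2)
    (hcontr : ∀ x v, v ≠ 0 → ⟪v, fderiv ℝ A x (F x) v⟫ + ⟪fderiv ℝ F x v, A x v⟫ +
      ⟪v, A x (fderiv ℝ F x v)⟫ + 2 * lam * ⟪v, A x v⟫ < 0)
    {x₁ x₂ d : ℝ → E} (hd : ∀ t ≥ (0 : ℝ), ‖d t‖ ≤ ε)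
    (hx₁ : ∀ t ∈ Ici (0 : ℝ), HasDerivWithinAt x₁ (F (x₁ t)) (Ici 0) t)
    (hx₂ : ∀ t ∈ Ici (0 : ℝ), HasDerivWithinAt x₂ (F (x₂ t) + d t) (Ici 0) t)
    {t : ℝ} (ht : 0 ≤ t) :
    chainDist A (x₁ t) (x₂ t) ≤ chainDist A (x₁ 0) (x₂ 0) * Real.exp (-lam * t) +
      √mhi * ε / lam * (1 - Real.exp (-lam * t)) := by
  have : CompleteSpace E := FiniteDimensional.complete ℝ E
  have hAc := hA.continuous
  have hcont : ContinuousOn (fun t => chainDist A (x₁ t) (x₂ t)) (Icc 0 t) := by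
    refine (continuous_chainDist hlo.le hhi hAc hAlo hAhi).comp_continuousOn
      (ContinuousOn.prodMk ?_ ?_)
    · exact fun s hs => (hx₁ s hs.1).continuousWithinAt.mono Icc_subset_Ici_self
    · exact fun s hs => (hx₂ s hs.1).continuousWithinAt.mono Icc_subset_Ici_self
  have key := le_gronwallBound_of_liminf_deriv_right_le
    (f' := fun t => -lam * chainDist A (x₁ t) (x₂ t) + √mhi * ε) hcont
    (fun s hs r hr => ?_) le_rfl (fun _ _ => le_rfl) t (right_mem_Icc.2 ht)
  · rw [gronwallBound_of_K_ne_0 (neg_ne_zero.2 hlam.ne'), sub_zero] at key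
    refine key.trans (le_of_eq ?_)
    rw [div_neg]
    ring
  refine Eventually.frequently ?_
  obtain ⟨c, hc, hcr⟩ : ∃ c > 0,
      -lam * chainDist A (x₁ s) (x₂ s) + √mhi * (c + (c + ε)) < r := by
    have hl : Tendsto (fun c : ℝ => -lam * chainDist A (x₁ s) (x₂ s) + √mhi * (c + (c + ε)))
        (𝓝[>] 0) (𝓝 (-lam * chainDist A (x₁ s) (x₂ s) + √mhi * (0 + (0 + ε)))) :=
      (Continuous.tendsto (by fun_prop) 0).mono_left nhdsWithin_le_nhds
    have := hl.eventually_lt_const (u := r) (by simpa using hr)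
    obtain ⟨c, h₁, h₂⟩ := (this.and self_mem_nhdsWithin).exists
    exact ⟨c, h₂, h₁⟩
  have hshift : Tendsto (fun z => z - s) (𝓝[>] s) (𝓝[>] 0) := by
    refine tendsto_nhdsWithin_of_tendsto_nhds_of_eventually_within _ ?_ ?_
    · exact ((continuous_sub_right s).tendsto' s 0 (sub_self s)).mono_left nhdsWithin_le_nhds
    · filter_upwards [self_mem_nhdsWithin] with z hz
      exact sub_pos.2 (mem_Ioi.1 hz)
  filter_upwards [hshift.eventually (eventually_chainDist_euler_le hlam hlo hhi hA hF hAlo hAhi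
      hcontr (x₁ s) (x₂ s)),
    eventually_norm_sub_le_of_hasDerivWithinAt_Ici hs.1 (hx₁ s hs.1) hc,
    eventually_norm_sub_le_of_hasDerivWithinAt_Ici hs.1 (hx₂ s hs.1) hc,
    self_mem_nhdsWithin] with z hE h₁ h₂ hz
  have hz' : 0 < z - s := sub_pos.2 hz
  have h₂' : ‖x₂ z - (x₂ s + (z - s) • F (x₂ s))‖ ≤ (c + ε) * (z - s) := by
    have heq : x₂ z - (x₂ s + (z - s) • F (x₂ s)) =
        (x₂ z - (x₂ s + (z - s) • (F (x₂ s) + d s))) + (z - s) • d s := by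
      rw [smul_add]
      abel
    rw [heq]
    refine (norm_add_le _ _).trans ?_
    rw [norm_smul, Real.norm_of_nonneg hz'.le]
    nlinarith [hd s hs.1]
  have htot := chainDist_le_add_mul_norm hlo.le hhi hAc hAlo hAhi
    (x₁ s + (z - s) • F (x₁ s)) (x₂ s + (z - s) • F (x₂ s)) (x₁ z) (x₂ z)
  have hsum := mul_le_mul_of_nonneg_left (add_le_add h₁ h₂') (Real.sqrt_nonneg mhi)
  rw [inv_mul_lt_iff₀ hz']
  nlinarith [mul_lt_mul_of_pos_left hcr hz']

theorem toEuclideanCLM_eq_sum {n : ℕ} (N : Matrix (Fin n) (Fin n) ℝ) :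
    Matrix.toEuclideanCLM (𝕜 := ℝ) N =
      ∑ i, ∑ j, N i j • Matrix.toEuclideanCLM (𝕜 := ℝ) (Matrix.single i j (1 : ℝ)) := by
  conv_lhs => rw [Matrix.matrix_eq_sum_single N]
  simp only [map_sum, ← map_smul, Matrix.smul_single, smul_eq_mul, mul_one]

theorem contDiff_toEuclideanCLM {n : ℕ}
    {M : EuclideanSpace ℝ (Fin n) → Matrix (Fin n) (Fin n) ℝ}
    (hM : ∀ i j, ContDiff ℝ 1 fun x => M x i j) :
    ContDiff ℝ 1 fun x => Matrix.toEuclideanCLM (𝕜 := ℝ) (M x) := by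
  simp_rw [fun x => toEuclideanCLM_eq_sum (M x)]
  exact ContDiff.sum fun i _ => ContDiff.sum fun j _ => (hM i j).smul contDiff_const

theorem fderiv_toEuclideanCLM_apply {n : ℕ}
    {M : EuclideanSpace ℝ (Fin n) → Matrix (Fin n) (Fin n) ℝ}
    (hM : ∀ i j, ContDiff ℝ 1 fun x => M x i j) (x w : EuclideanSpace ℝ (Fin n)) :
    fderiv ℝ (fun x => Matrix.toEuclideanCLM (𝕜 := ℝ) (M x)) x w =
      Matrix.toEuclideanCLM (𝕜 := ℝ)
        (Matrix.of fun i j => fderiv ℝ (fun y => M y i j) x w) := by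
  have h : HasFDerivAt (fun x => Matrix.toEuclideanCLM (𝕜 := ℝ) (M x))
      (∑ i, ∑ j, (fderiv ℝ (fun y => M y i j) x).smulRight
        (Matrix.toEuclideanCLM (𝕜 := ℝ) (Matrix.single i j (1 : ℝ)))) x := by
    simp_rw [fun x => toEuclideanCLM_eq_sum (M x)]
    exact HasFDerivAt.fun_sum fun i _ => HasFDerivAt.fun_sum fun j _ =>
      ((hM i j).differentiable one_ne_zero x).hasFDerivAt.smul_const
        (Matrix.toEuclideanCLM (𝕜 := ℝ) (Matrix.single i j (1 : ℝ)))
  rw [h.fderiv, toEuclideanCLM_eq_sum]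
  simp

theorem inner_toEuclideanCLM_nonneg {n : ℕ} {N : Matrix (Fin n) (Fin n) ℝ} (hN : N.PosSemidef)
    (v : EuclideanSpace ℝ (Fin n)) : 0 ≤ ⟪v, Matrix.toEuclideanCLM (𝕜 := ℝ) N v⟫ := by
  rw [Matrix.inner_toEuclideanCLM]
  simpa using hN.dotProduct_mulVec_nonneg v.ofLp

theorem inner_toEuclideanCLM_pos {n : ℕ} {N : Matrix (Fin n) (Fin n) ℝ} (hN : N.PosDef)
    {v : EuclideanSpace ℝ (Fin n)} (hv : v ≠ 0) :
    0 < ⟪v, Matrix.toEuclideanCLM (𝕜 := ℝ) N v⟫ := by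
  rw [Matrix.inner_toEuclideanCLM]
  simpa using hN.dotProduct_mulVec_pos (x := v.ofLp) (by simpa using hv)

theorem inner_toEuclideanCLM_transpose {n : ℕ} (N : Matrix (Fin n) (Fin n) ℝ)
    (v w : EuclideanSpace ℝ (Fin n)) :
    ⟪v, Matrix.toEuclideanCLM (𝕜 := ℝ) Nᵀ w⟫ = ⟪Matrix.toEuclideanCLM (𝕜 := ℝ) N v, w⟫ := by
  rw [← Matrix.conjTranspose_eq_transpose_of_trivial, ← Matrix.star_eq_conjTranspose, map_star,
    ContinuousLinearMap.star_eq_adjoint, ContinuousLinearMap.adjoint_inner_right]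

/-- Theorem 1 (robustness under bounded disturbance): under the contraction condition
`∂_F M(x) + DF(x)ᵀM(x) + M(x)DF(x) + 2λM(x) ≺ 0` with `m̲·I ⪯ M(x) ⪯ m̄·I`, if `x₁` solves
`ẋ₁ = F(x₁)` and `x₂` solves the perturbed system `ẋ₂ = F(x₂) + d(t)` with `‖d(t)‖₂ ≤ ε`,
and `R₀` is the geodesic distance between `x₁(0)` and `x₂(0)` under the metric `M`, then
`‖x₁(t) − x₂(t)‖₂ ≤ (R₀/√m̲)·e^{−λt} + √(m̄/m̲)·(ε/λ)·(1 − e^{−λt})` for all `t ≥ 0`. -/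
theorem contraction_robust_tracking {n : ℕ} (lam mlo mhi ε : ℝ)
    (hlam : 0 < lam) (hmlo : 0 < mlo) (hm : mlo ≤ mhi) (hε : 0 ≤ ε)
    (F : EuclideanSpace ℝ (Fin n) → EuclideanSpace ℝ (Fin n))
    (hF : ContDiff ℝ 1 F)
    (M : EuclideanSpace ℝ (Fin n) → Matrix (Fin n) (Fin n) ℝ)
    (hM : ∀ i j, ContDiff ℝ 1 (fun x => M x i j))
    (hMsymm : ∀ x, (M x).IsSymm)
    (hMlb : ∀ x, (M x - mlo • (1 : Matrix (Fin n) (Fin n) ℝ)).PosSemidef)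
    (hMub : ∀ x, (mhi • (1 : Matrix (Fin n) (Fin n) ℝ) - M x).PosSemidef)
    -- the Jacobian of `F` as a matrix
    (DF : EuclideanSpace ℝ (Fin n) → Matrix (Fin n) (Fin n) ℝ)
    (hDF : ∀ x, DF x = Matrix.toEuclideanLin.symm (fderiv ℝ F x : _ →ₗ[ℝ] _))
    -- the directional (Lie) derivative of `M` along `F`
    (LieDM : EuclideanSpace ℝ (Fin n) → Matrix (Fin n) (Fin n) ℝ)
    (hLieDM : ∀ x, LieDM x = Matrix.of fun i j => fderiv ℝ (fun y => M y i j) x (F x))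
    -- the contraction condition
    (hcontr : ∀ x,
      (-(LieDM x + (DF x)ᵀ * M x + M x * DF x + (2 * lam) • M x)).PosDef)
    -- unperturbed and perturbed trajectories
    (x₁ x₂ : ℝ → EuclideanSpace ℝ (Fin n))
    (d : ℝ → EuclideanSpace ℝ (Fin n))
    (hd : ∀ t ≥ (0 : ℝ), ‖d t‖ ≤ ε)
    (hx₁ : ∀ t ∈ Set.Ici (0 : ℝ), HasDerivWithinAt x₁ (F (x₁ t)) (Set.Ici 0) t)
    (hx₂ : ∀ t ∈ Set.Ici (0 : ℝ), HasDerivWithinAt x₂ (F (x₂ t) + d t) (Set.Ici 0) t)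
    -- the geodesic distance between the initial states under the metric `M`
    (R₀ : ℝ)
    (hR₀ : R₀ = sInf {r : ℝ | ∃ γ : ℝ → EuclideanSpace ℝ (Fin n),
      ContDiffOn ℝ 1 γ (Set.Icc 0 1) ∧ γ 0 = x₁ 0 ∧ γ 1 = x₂ 0 ∧
      r = ∫ s in (0 : ℝ)..1,
        Real.sqrt ⟪derivWithin γ (Set.Icc 0 1) s,
          Matrix.toEuclideanLin (M (γ s)) (derivWithin γ (Set.Icc 0 1) s)⟫}) :
    ∀ t ≥ (0 : ℝ),
      ‖x₁ t - x₂ t‖ ≤ (R₀ / Real.sqrt mlo) * Real.exp (-lam * t) +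
        Real.sqrt (mhi / mlo) * (ε / lam) * (1 - Real.exp (-lam * t)) := by
  have hhi : 0 ≤ mhi := hmlo.le.trans hm
  let A := fun x => Matrix.toEuclideanCLM (𝕜 := ℝ) (M x)
  have hA : ContDiff ℝ 1 A := contDiff_toEuclideanCLM hM
  have hAlo : ∀ x v, mlo * ‖v‖ ^ 2 ≤ ⟪v, A x v⟫ := fun x v => by
    have := inner_toEuclideanCLM_nonneg (hMlb x) v
    simp only [map_sub, map_smul, map_one, _root_.sub_apply,
      _root_.smul_apply, one_apply_eq_self, inner_sub_right,
      inner_smul_right, real_inner_self_eq_norm_sq] at this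
    linarith
  have hAhi : ∀ x v, ⟪v, A x v⟫ ≤ mhi * ‖v‖ ^ 2 := fun x v => by
    have := inner_toEuclideanCLM_nonneg (hMub x) v
    simp only [map_sub, map_smul, map_one, _root_.sub_apply,
      _root_.smul_apply, one_apply_eq_self, inner_sub_right,
      inner_smul_right, real_inner_self_eq_norm_sq] at this
    linarith
  have hDF' : ∀ x v, Matrix.toEuclideanCLM (𝕜 := ℝ) (DF x) v = fderiv ℝ F x v := fun x v => by
    have h : Matrix.toEuclideanLin (DF x) v = fderiv ℝ F x v := by
      rw [hDF, LinearEquiv.apply_symm_apply]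
      rfl
    exact h
  have hcontr' : ∀ x v, v ≠ 0 → ⟪v, fderiv ℝ A x (F x) v⟫ + ⟪fderiv ℝ F x v, A x v⟫ +
      ⟪v, A x (fderiv ℝ F x v)⟫ + 2 * lam * ⟪v, A x v⟫ < 0 := fun x v hv => by
    have := inner_toEuclideanCLM_pos (hcontr x) hv
    simp only [map_neg, map_add, map_smul, map_mul, _root_.neg_apply,
      _root_.add_apply, _root_.smul_apply,
      ContinuousLinearMap.mul_def, ContinuousLinearMap.comp_apply, inner_neg_right, inner_add_right, inner_smul_right,
      inner_toEuclideanCLM_transpose, hDF'] at this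
    rw [fderiv_toEuclideanCLM_apply hM, ← hLieDM]
    linarith
  have hR : chainDist A (x₁ 0) (x₂ 0) ≤ R₀ := by
    rw [hR₀]
    refine le_csInf ⟨_, fun s => x₁ 0 + s • (x₂ 0 - x₁ 0), ?_, by simp, by simp, rfl⟩ ?_
    · exact ContDiff.contDiffOn (by fun_prop)
    · rintro r ⟨γ, hγ, h0, h1, hr⟩
      rw [← h0, ← h1]
      exact chainDist_le hmlo.le hA.continuous hAlo (.path hγ hr.ge)
  intro t ht
  have hlower := mul_norm_le_chainDist hmlo.le hhi hA.continuous hAlo hAhi (x₁ t) (x₂ t)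
  have hupper := chainDist_trajectories_le hlam hmlo hhi hA hF hAlo hAhi hcontr' hd hx₁ hx₂ ht
  have hs : 0 < √mlo := Real.sqrt_pos.2 hmlo
  rw [norm_sub_rev, Real.sqrt_div hhi]
  calc ‖x₂ t - x₁ t‖ ≤ (R₀ * Real.exp (-lam * t) +
        √mhi * ε / lam * (1 - Real.exp (-lam * t))) / √mlo := by
        rw [le_div_iff₀' hs]
        exact hlower.trans (hupper.trans (by gcongr))
    _ = _ := by
        field_simp
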